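/- Let L be a finite-dimensional semisimple Lie algebra over ℂ with Killing form κ, H ⊆ L a Cartan subalgebra, and Δ ⊆ H* the set of roots (the nonzero weights of the adjoint action of H on L), with root spaces L_β. Suppose chosen root vectors x_β ∈ L_β for each β ∈ Δ normalized so that κ(x_β, x_{−β}) = 1 for every β ∈ Δ. Let S ⊆ H* be a linear subspace (in the paper S has dimension 2), and let P ⊆ Δ ∩ S be any subset such that Δ ∩ S is the disjoint union of P and −P (for example P = Δ_+ ∩ S for a choice of positive roots). Then for every root α ∈ Δ ∩ S, the element x_α x_{−α} of the universal enveloping algebra U(L) commutes with the element Σ_{β ∈ P} x_β x_{−β} ∈ U(L). (This is the verification that t_α ↦ e_α f_α defines a homomorphism from the holonomy Lie algebra t_Δ to U(L).) -/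

import Mathlib

open UniversalEnvelopingAlgebra

/-- In an enveloping algebra, the commutator of an element of `L` with a product of two. -/
lemma ι_mul_ι_mul_ι_sub {K L : Type*} [CommRing K] [LieRing L] [LieAlgebra K L] (a b c : L) :
    ι K a * (ι K b * ι K c) - ι K b * ι K c * ι K a =
      ι K ⁅a, b⁆ * ι K c + ι K b * ι K ⁅a, c⁆ := by
  simp only [LieHom.map_lie, LieRing.of_associative_ring_bracket]
  noncomm_ring

/-- If `h` acts on `b` and `c` by opposite scalars, then `h` commutes with `b * c` in the
enveloping algebra. -/
lemma commute_ι_mul_ι_of_lie_eq_smul {K L : Type*} [CommRing K] [LieRing L] [LieAlgebra K L]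
    {h b c : L} {t : K} (hb : ⁅h, b⁆ = t • b) (hc : ⁅h, c⁆ = -t • c) :
    Commute (ι K h) (ι K b * ι K c) := by
  refine sub_eq_zero.mp ?_
  rw [ι_mul_ι_mul_ι_sub, hb, hc]
  simp

/-- The commutator of a root vector with the root part of a Casimir element attached to a
symmetric set `F` of roots, with respect to an invariant form `B`. -/
lemma ι_mul_sum_sub_sum_mul_ι {K L D : Type*} [CommRing K] [LieRing L] [LieAlgebra K L]
    [AddCommGroup D] (B : L → L → K) (hBsymm : ∀ a b, B a b = B b a)
    (hB : ∀ a b c : L, B ⁅a, b⁆ c = -B b ⁅a, c⁆)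
    (x : D → L) (F : Finset D) (hF₀ : 0 ∉ F) (hneg : ∀ β ∈ F, -β ∈ F)
    {α : D} (hα : α ∈ F)
    (hadd : ∀ β ∈ F, α + β ∈ F → ⁅x α, x β⁆ = B ⁅x α, x β⁆ (x (-(α + β))) • x (α + β))
    (hzero : ∀ β ∈ F, α + β ∉ F → α + β ≠ 0 → ⁅x α, x β⁆ = 0) :
    ι K (x α) * (∑ β ∈ F, ι K (x β) * ι K (x (-β))) -
        (∑ β ∈ F, ι K (x β) * ι K (x (-β))) * ι K (x α) =
      ι K ⁅x α, x (-α)⁆ * ι K (x α) + ι K (x α) * ι K ⁅x α, x (-α)⁆ := by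
  classical
  let N : D → K := fun β ↦ B ⁅x α, x β⁆ (x (-(α + β)))
  have hN (β : D) : N (-(α + β)) = -N β := by
    simp only [N]
    rw [hB, hBsymm (x (-(α + β)))]
    congr 4
    abel
  have key (β : D) (hβ : β ∈ F) : ⁅x α, x β⁆ =
      (if β = -α then ⁅x α, x (-α)⁆ else 0) + if α + β ∈ F then N β • x (α + β) else 0 := by
    by_cases h : β = -α
    · subst h
      simp [hF₀]
    · by_cases h' : α + β ∈ F
      · simpa only [h, h', if_true, if_false, zero_add] using hadd β hβ h'
      · simpa [h, h'] using hzero β hβ h' fun h₀ ↦ h (neg_eq_of_add_eq_zero_right h₀).symm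
  have first : ∑ β ∈ F, ι K ⁅x α, x β⁆ * ι K (x (-β)) = ι K ⁅x α, x (-α)⁆ * ι K (x α) +
      ∑ β ∈ F with α + β ∈ F, N β • (ι K (x (α + β)) * ι K (x (-β))) := by
    rw [Finset.sum_filter]
    trans ∑ β ∈ F, ((if β = -α then ι K ⁅x α, x (-α)⁆ * ι K (x α) else 0) +
      if α + β ∈ F then N β • (ι K (x (α + β)) * ι K (x (-β))) else 0)
    · refine Finset.sum_congr rfl fun β hβ ↦ ?_
      rw [key β hβ]
      split_ifs with h₁ h₂ h₂ <;> simp [h₁, add_mul, -LieHom.map_lie]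
    · simp [Finset.sum_add_distrib, hneg α hα]
  have second : ∑ β ∈ F, ι K (x β) * ι K ⁅x α, x (-β)⁆ = ι K (x α) * ι K ⁅x α, x (-α)⁆ +
      ∑ β ∈ F with α - β ∈ F, N (-β) • (ι K (x β) * ι K (x (α - β))) := by
    rw [Finset.sum_filter]
    trans ∑ β ∈ F, ((if β = α then ι K (x α) * ι K ⁅x α, x (-α)⁆ else 0) +
      if α - β ∈ F then N (-β) • (ι K (x β) * ι K (x (α - β))) else 0)
    · refine Finset.sum_congr rfl fun β hβ ↦ ?_
      rw [key (-β) (hneg β hβ)]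
      simp only [neg_inj, ← sub_eq_add_neg]
      split_ifs with h₁ h₂ h₂ <;> simp [h₁, mul_add, -LieHom.map_lie]
    · simp [Finset.sum_add_distrib, hα]
  have cancel : ∑ β ∈ F with α - β ∈ F, N (-β) • (ι K (x β) * ι K (x (α - β))) =
      -∑ β ∈ F with α + β ∈ F, N β • (ι K (x (α + β)) * ι K (x (-β))) := by
    rw [← Finset.sum_neg_distrib]
    refine Finset.sum_nbij' (fun β ↦ β - α) (fun β ↦ α + β) ?_ ?_ ?_ ?_ ?_
    · intro β hβ
      rw [Finset.mem_filter] at hβ ⊢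
      exact ⟨by simpa using hneg _ hβ.2, by simpa using hβ.1⟩
    · intro β hβ
      rw [Finset.mem_filter] at hβ ⊢
      exact ⟨hβ.2, by simpa using hneg _ hβ.1⟩
    · intro β _
      abel
    · intro β _
      abel
    · intro β _
      obtain ⟨γ, rfl⟩ : ∃ γ, β = α + γ := ⟨β - α, by abel⟩
      rw [hN, sub_add_cancel_left, add_sub_cancel_left, neg_smul]
  rw [Finset.mul_sum, Finset.sum_mul, ← Finset.sum_sub_distrib]
  simp only [ι_mul_ι_mul_ι_sub]
  rw [Finset.sum_add_distrib, first, second, cancel]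
  abel

/-- Let `L` be a finite-dimensional semisimple complex Lie algebra with Killing form `κ`,
`H` a Cartan subalgebra, and `Δ` the set of roots (nonzero weights of the adjoint action of
`H` on `L`).  Choose root vectors `x_β ∈ L_β` normalized so that `κ(x_β, x_{−β}) = 1` for all
roots `β`.  Let `S ⊆ H*` be a linear subspace and `P ⊆ Δ ∩ S` with `Δ ∩ S` the disjoint union
of `P` and `−P`.  Then for every root `α ∈ Δ ∩ S`, the element `x_α x_{−α}` of `U(L)` commutes
with `Σ_{β ∈ P} x_β x_{−β}`.  (This verifies that `t_α ↦ e_α f_α` defines a homomorphism from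
the holonomy Lie algebra `t_Δ` to `U(L)`.) -/
theorem holonomy_relation_in_envelopingAlgebra
    {L : Type*} [LieRing L] [LieAlgebra ℂ L] [Module.Finite ℂ L]
    [LieAlgebra.IsSemisimple ℂ L]
    (H : LieSubalgebra ℂ L) [H.IsCartanSubalgebra]
    (Δ : Set (Module.Dual ℂ H))
    (hΔ : Δ = {β : Module.Dual ℂ H | β ≠ 0 ∧ LieAlgebra.rootSpace H (β : H → ℂ) ≠ ⊥})
    (x : Module.Dual ℂ H → L)
    (hx : ∀ β : Module.Dual ℂ H, x β ∈ LieAlgebra.rootSpace H (β : H → ℂ))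
    (hnorm : ∀ β ∈ Δ, killingForm ℂ L (x β) (x (-β)) = 1)
    (S : Submodule ℂ (Module.Dual ℂ H))
    (P : Finset (Module.Dual ℂ H))
    (hP : ∀ β : Module.Dual ℂ H, (β ∈ Δ ∧ β ∈ S) ↔ (β ∈ P ∨ -β ∈ P))
    (hPdisj : ∀ β ∈ P, -β ∉ P)
    (α : Module.Dual ℂ H) (hα : α ∈ Δ) (hαS : α ∈ S) :
    Commute (ι ℂ (x α) * ι ℂ (x (-α)))
      (∑ β ∈ P, ι ℂ (x β) * ι ℂ (x (-β))) := by
  classical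
  subst hΔ
  have hne {β : Module.Dual ℂ H}
      (hβ : β ∈ {β : Module.Dual ℂ H | β ≠ 0 ∧ LieAlgebra.rootSpace H (β : H → ℂ) ≠ ⊥}) :
      x β ≠ 0 := fun h ↦ by simpa [h] using hnorm β hβ
  have hdim {β : Module.Dual ℂ H} (hβ : β ≠ 0 ∧ LieAlgebra.rootSpace H (β : H → ℂ) ≠ ⊥)
      {y : L} (hy : y ∈ LieAlgebra.rootSpace H (β : H → ℂ)) :
      y = killingForm ℂ L y (x (-β)) • x β := by
    obtain ⟨c, rfl⟩ : ∃ c : ℂ, c • x β = y := by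
      let w : LieModule.Weight ℂ H L := ⟨β, hβ.2⟩
      have hw : w.IsNonZero := fun h ↦ hβ.1 (DFunLike.coe_injective h)
      obtain ⟨c, hc⟩ := (finrank_eq_one_iff_of_nonzero'
        (⟨x β, hx β⟩ : LieAlgebra.rootSpace H (β : H → ℂ)) (by simpa using hne hβ)).mp
        (LieAlgebra.IsKilling.finrank_rootSpace_eq_one w hw) ⟨y, hy⟩
      exact ⟨c, congrArg Subtype.val hc⟩
    simp [hnorm β hβ]
  have hcartan (γ β : Module.Dual ℂ H) :
      Commute (ι ℂ ⁅x γ, x (-γ)⁆) (ι ℂ (x β) * ι ℂ (x (-β))) := by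
    have h₀ : ⁅x γ, x (-γ)⁆ ∈ LieAlgebra.rootSpace H (0 : H → ℂ) := by
      simpa using LieAlgebra.lie_mem_genWeightSpace_of_mem_genWeightSpace (hx γ) (hx (-γ))
    rw [LieAlgebra.rootSpace_zero_eq] at h₀
    exact commute_ι_mul_ι_of_lie_eq_smul
      (LieAlgebra.IsKilling.lie_eq_smul_of_mem_rootSpace (hx β) ⟨_, h₀⟩)
      (LieAlgebra.IsKilling.lie_eq_smul_of_mem_rootSpace (hx (-β)) ⟨_, h₀⟩)
  let F := P ∪ P.image Neg.neg
  have hmemF (β : Module.Dual ℂ H) : β ∈ F ↔ β ∈ P ∨ -β ∈ P := by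
    simp [F, neg_eq_iff_eq_neg]
  have hF (β : Module.Dual ℂ H) : β ∈ F ↔
      (β ≠ 0 ∧ LieAlgebra.rootSpace H (β : H → ℂ) ≠ ⊥) ∧ β ∈ S :=
    (hmemF β).trans (hP β).symm
  have hFneg (β : Module.Dual ℂ H) (hβ : β ∈ F) : -β ∈ F := by
    rw [hmemF] at hβ ⊢
    rwa [neg_neg, or_comm]
  have hcomm (γ : Module.Dual ℂ H) (hγ : γ ∈ F) := ι_mul_sum_sub_sum_mul_ι
    (fun a b ↦ killingForm ℂ L a b) (LieModule.traceForm_comm ℂ L L)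
    (LieModule.traceForm_apply_lie_apply' ℂ L L) x F (by simp [hF]) hFneg hγ
    (fun β _ h ↦ hdim ((hF _).mp h).1
      (LieAlgebra.lie_mem_genWeightSpace_of_mem_genWeightSpace (hx γ) (hx β)))
    (fun β hβ h h₀ ↦ by
      have hmem := LieAlgebra.lie_mem_genWeightSpace_of_mem_genWeightSpace (hx γ) (hx β)
      by_contra hne₀
      refine h ((hF _).mpr ⟨⟨h₀, fun hbot ↦ hne₀ ?_⟩,
        S.add_mem ((hF _).mp hγ).2 ((hF _).mp hβ).2⟩)
      have hbot' : LieAlgebra.rootSpace H ((γ : H → ℂ) + β) = ⊥ := hbot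
      simpa [hbot'] using hmem)
  have hαF : α ∈ F := (hF α).mpr ⟨hα, hαS⟩
  have hpos := hcomm α hαF
  have hminus := hcomm (-α) (hFneg α hαF)
  rw [neg_neg, ← lie_skew, map_neg] at hminus
  have hcasimir : Commute (ι ℂ (x α) * ι ℂ (x (-α)))
      (∑ β ∈ F, ι ℂ (x β) * ι ℂ (x (-β))) := by
    have hh := (hcartan α α).eq
    generalize ∑ β ∈ F, ι ℂ (x β) * ι ℂ (x (-β)) = Ω at *
    generalize ι ℂ ⁅x α, x (-α)⁆ = h at *
    generalize ι ℂ (x α) = e at *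
    generalize ι ℂ (x (-α)) = f at *
    refine sub_eq_zero.mp ?_
    calc e * f * Ω - Ω * (e * f) = e * (f * Ω - Ω * f) + (e * Ω - Ω * e) * f := by noncomm_ring
      _ = h * (e * f) - e * f * h := by rw [hpos, hminus]; noncomm_ring
      _ = 0 := sub_eq_zero.mpr hh
  have hdouble : (2 : ℂ) • ∑ β ∈ P, ι ℂ (x β) * ι ℂ (x (-β)) =
      ∑ β ∈ F, ι ℂ (x β) * ι ℂ (x (-β)) + ∑ β ∈ P, ι ℂ ⁅x β, x (-β)⁆ := by
    have hdisj : Disjoint P (P.image Neg.neg) := by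
      rw [Finset.disjoint_right]
      intro β hβ
      obtain ⟨γ, hγ, rfl⟩ := Finset.mem_image.mp hβ
      exact hPdisj γ hγ
    rw [Finset.sum_union hdisj, Finset.sum_image neg_injective.injOn, add_assoc,
      ← Finset.sum_add_distrib, two_smul]
    congr 1
    refine Finset.sum_congr rfl fun β _ ↦ ?_
    simp [LieRing.of_associative_ring_bracket]
  have htwo := (hcasimir.add_right (Commute.sum_right P (fun β ↦ ι ℂ ⁅x β, x (-β)⁆) _
    fun β _ ↦ (hcartan β α).symm))
  rw [← hdouble] at htwo
  simpa [smul_smul] using htwo.smul_right (2⁻¹ : ℂ)
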